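/- For every x ∈ ℚ_p⁴ \ {0} and every t > 0, the heat kernel has the absolutely convergent series expansion Z(x,t) = Σ_{m=1}^{∞} ((−1)^m / m!) · ((1 − p^{αm})/(1 − p^{−αm−2})) · κ^m t^m |f(x)|_p^{−αm−2}. -/

import Mathlib

open MeasureTheory Real Filter Set

noncomputable section

namespace PadicParabolic

variable (p : ℕ) [Fact p.Prime]

instance : MeasurableSpace ℚ_[p] := borel _
instance : BorelSpace ℚ_[p] := ⟨rfl⟩

/-- The four dimensional vector space over `ℚ_[p]`, with the max-norm
`‖x‖ = max_{1 ≤ i ≤ 4} |x_i|_p`. -/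
abbrev V (p : ℕ) [Fact p.Prime] := Fin 4 → ℚ_[p]

/-- `a` is a quadratic non-residue modulo `p`. -/
def IsQNR (a : ℤ) : Prop := ∀ b : ZMod p, b ^ 2 ≠ (a : ZMod p)

/-- The elliptic quadratic form `f(x) = x₁² − a x₂² − p x₃² + a p x₄²`. -/
def qf (a : ℤ) (x : V p) : ℚ_[p] :=
  x 0 ^ 2 - (a : ℚ_[p]) * x 1 ^ 2 - (p : ℚ_[p]) * x 2 ^ 2 + (a : ℚ_[p]) * (p : ℚ_[p]) * x 3 ^ 2

/-- The dual elliptic quadratic form `f°(ξ) = a p ξ₁² − p ξ₂² − a ξ₃² + ξ₄²`. -/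
def qfc (a : ℤ) (x : V p) : ℚ_[p] :=
  (a : ℚ_[p]) * (p : ℚ_[p]) * x 0 ^ 2 - (p : ℚ_[p]) * x 1 ^ 2 - (a : ℚ_[p]) * x 2 ^ 2 + x 3 ^ 2

/-- `χ` is the standard additive character `χ(y) = exp(2πi {y}_p)` of `ℚ_p`, characterized as
the unique continuous function with `χ(m/pⁿ) = exp(2πi m/pⁿ)`. -/
def IsStdChar (χ : ℚ_[p] → ℂ) : Prop :=
  Continuous χ ∧ ∀ (m : ℤ) (n : ℕ),
    χ ((m : ℚ_[p]) / (p : ℚ_[p]) ^ n) =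
      Complex.exp (2 * (Real.pi : ℂ) * Complex.I * (m : ℂ) / (p : ℂ) ^ n)

/-- The heat kernel `Z(x,t) = ∫_{ℚ_p⁴} χ(ξ·x) e^{−κ t |f°(ξ)|_p^α} d⁴ξ`. -/
def heatZ (μ : Measure (V p)) (χ : ℚ_[p] → ℂ) (a : ℤ) (κ α : ℝ) (x : V p) (t : ℝ) : ℂ :=
  ∫ ξ, χ (∑ i, ξ i * x i) * (Real.exp (-(κ * t * ‖qfc p a ξ‖ ^ α)) : ℂ) ∂μ

/-- The `m`-th term of the series expansion of the heat kernel: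
`((−1)^m/m!) ((1 − p^{αm})/(1 − p^{−αm−2})) κ^m t^m |f(x)|_p^{−αm−2}`. -/
def heatTerm (a : ℤ) (κ α : ℝ) (x : V p) (t : ℝ) (m : ℕ) : ℝ :=
  (-1 : ℝ) ^ m / m.factorial *
    ((1 - (p : ℝ) ^ (α * m)) / (1 - (p : ℝ) ^ (-(α * m) - 2))) *
    (κ ^ m * t ^ m * ‖qf p a x‖ ^ (-(α * m) - 2))


section Norms

variable {p}

lemma one_lt_cast : (1 : ℝ) < p := by exact_mod_cast (Fact.out : p.Prime).one_lt

lemma exists_norm_eq_zpow {x : ℚ_[p]} (hx : x ≠ 0) : ∃ n : ℤ, ‖x‖ = (p : ℝ) ^ n :=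
  ⟨_, Padic.norm_eq_zpow_neg_valuation hx⟩

lemma norm_sq_le_zpow (x : ℚ_[p]) (k : ℤ) :
    ‖x‖ ^ 2 ≤ (p : ℝ) ^ k ↔ ‖x‖ ≤ (p : ℝ) ^ (k / 2) := by
  have hp := one_lt_cast (p := p)
  rcases eq_or_ne x 0 with rfl | hx
  · rw [norm_zero, zero_pow two_ne_zero]
    exact iff_of_true (by positivity) (by positivity)
  · obtain ⟨n, hn⟩ := exists_norm_eq_zpow hx
    rw [hn, ← zpow_natCast, ← zpow_mul, zpow_le_zpow_iff_right₀ hp, zpow_le_zpow_iff_right₀ hp]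
    push_cast
    omega

lemma IsQNR.norm_eq_one {a : ℤ} (ha : IsQNR p a) : ‖(a : ℚ_[p])‖ = 1 := by
  rw [Padic.norm_intCast_eq_one_iff, isCoprime_comm,
    (Nat.prime_iff_prime_int.mp Fact.out).irreducible.coprime_iff_not_dvd,
    ← ZMod.intCast_zmod_eq_zero_iff_dvd _ p]
  exact fun h => ha 0 (by simp [h])

lemma IsQNR.norm_sq_sub_eq_one {a : ℤ} (ha : IsQNR p a) {w : ℚ_[p]} (hw : ‖w‖ = 1) :
    ‖w ^ 2 - (a : ℚ_[p])‖ = 1 := by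
  let z : ℤ_[p] := ⟨w, hw.le⟩
  have hz : ‖z ^ 2 - (a : ℤ_[p])‖ = 1 := by
    refine le_antisymm (PadicInt.norm_le_one _) (not_lt.mp fun h => ?_)
    have h' : z ^ 2 - (a : ℤ_[p]) ∈ RingHom.ker (PadicInt.toZMod (p := p)) := by
      rw [PadicInt.ker_toZMod]
      exact PadicInt.mem_nonunits.mpr h
    rw [RingHom.mem_ker, map_sub, map_pow, map_intCast, sub_eq_zero] at h'
    exact ha _ h'
  rw [PadicInt.norm_def] at hz
  push_cast at hz
  exact hz

lemma IsQNR.norm_sq_sub_mul_sq {a : ℤ} (ha : IsQNR p a) (u v : ℚ_[p]) :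
    ‖u ^ 2 - a * v ^ 2‖ = max (‖u‖ ^ 2) (‖v‖ ^ 2) := by
  rcases eq_or_ne ‖u‖ ‖v‖ with h | h
  · rcases eq_or_ne v 0 with rfl | hv
    · simp
    · have hw : ‖u / v‖ = 1 := by rw [norm_div, h, div_self (norm_ne_zero_iff.mpr hv)]
      have : u ^ 2 - a * v ^ 2 = ((u / v) ^ 2 - a) * v ^ 2 := by field_simp
      rw [this, norm_mul, ha.norm_sq_sub_eq_one hw, norm_pow, h, max_self, one_mul]
  · have h' : ‖u ^ 2‖ ≠ ‖-(a * v ^ 2)‖ := by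
      rw [norm_neg, norm_mul, ha.norm_eq_one, one_mul, norm_pow, norm_pow]
      exact fun e => h ((pow_left_inj₀ (norm_nonneg _) (norm_nonneg _) two_ne_zero).mp e)
    rw [sub_eq_add_neg, Padic.add_eq_max_of_ne h', norm_neg, norm_mul, ha.norm_eq_one, one_mul,
      norm_pow, norm_pow]

lemma norm_sq_ne_inv_mul_norm_sq {x : ℚ_[p]} (hx : x ≠ 0) (y : ℚ_[p]) :
    ‖x‖ ^ 2 ≠ (p : ℝ)⁻¹ * ‖y‖ ^ 2 := by
  have hp := one_lt_cast (p := p)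
  have hp0 : (p : ℝ) ≠ 0 := by positivity
  intro h
  rcases eq_or_ne y 0 with rfl | hy
  · simp [hx] at h
  · obtain ⟨n, hn⟩ := exists_norm_eq_zpow hx
    obtain ⟨m, hm⟩ := exists_norm_eq_zpow hy
    rw [hn, hm, ← zpow_neg_one, ← zpow_natCast, ← zpow_natCast, ← zpow_mul, ← zpow_mul,
      ← zpow_add₀ hp0] at h
    have := zpow_right_injective₀ (by positivity) hp.ne' h
    push_cast at this
    omega

lemma IsQNR.norm_qf {a : ℤ} (ha : IsQNR p a) (x : V p) :
    ‖qf p a x‖ = max (max (‖x 0‖ ^ 2) (‖x 1‖ ^ 2))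
      ((p : ℝ)⁻¹ * max (‖x 2‖ ^ 2) (‖x 3‖ ^ 2)) := by
  have e : qf p a x = (x 0 ^ 2 - a * x 1 ^ 2) + -(p * (x 2 ^ 2 - a * x 3 ^ 2)) := by
    simp only [qf]; ring
  have n2 : ‖-((p : ℚ_[p]) * (x 2 ^ 2 - a * x 3 ^ 2))‖ =
      (p : ℝ)⁻¹ * max (‖x 2‖ ^ 2) (‖x 3‖ ^ 2) := by
    rw [norm_neg, norm_mul, Padic.norm_p, ha.norm_sq_sub_mul_sq]
  rcases eq_or_ne (x 0 ^ 2 - a * x 1 ^ 2) 0 with h | h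
  · rw [e, ← ha.norm_sq_sub_mul_sq (x 0), h, zero_add, n2, norm_zero]
    exact (max_eq_right (by positivity)).symm
  · rw [e, Padic.add_eq_max_of_ne, n2, ha.norm_sq_sub_mul_sq]
    rw [n2, ha.norm_sq_sub_mul_sq]
    rw [← norm_ne_zero_iff, ha.norm_sq_sub_mul_sq] at h
    have sel : ∀ u v : ℚ_[p], ∃ w : ℚ_[p], max (‖u‖ ^ 2) (‖v‖ ^ 2) = ‖w‖ ^ 2 := fun u v =>
      (max_choice (‖u‖ ^ 2) (‖v‖ ^ 2)).elim (fun h => ⟨u, h⟩) (fun h => ⟨v, h⟩)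
    obtain ⟨w, hw⟩ := sel (x 0) (x 1)
    obtain ⟨w', hw'⟩ := sel (x 2) (x 3)
    rw [hw] at h ⊢
    rw [hw']
    exact norm_sq_ne_inv_mul_norm_sq (fun h0 => h (by simp [h0])) _

/-- The box of `ξ` with `|ξ_i|_p ≤ p ^ r_i`. -/
def box (p : ℕ) [Fact p.Prime] (r : Fin 4 → ℤ) : Set (V p) := {ξ | ∀ i, ‖ξ i‖ ≤ (p : ℝ) ^ r i}

/-- The exponents of the box `{ξ : |f°(ξ)|_p ≤ p ^ k}`. -/
def radii (k : ℤ) : Fin 4 → ℤ := ![(k + 1) / 2, (k + 1) / 2, k / 2, k / 2]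

lemma IsQNR.norm_qf_le_iff {a : ℤ} (ha : IsQNR p a) (x : V p) (k : ℤ) :
    ‖qf p a x‖ ≤ (p : ℝ) ^ k ↔
      (‖x 0‖ ≤ (p : ℝ) ^ (k / 2) ∧ ‖x 1‖ ≤ (p : ℝ) ^ (k / 2)) ∧
        ‖x 2‖ ≤ (p : ℝ) ^ ((k + 1) / 2) ∧ ‖x 3‖ ≤ (p : ℝ) ^ ((k + 1) / 2) := by
  have hp : (0 : ℝ) < p := zero_lt_one.trans one_lt_cast
  rw [ha.norm_qf, max_le_iff, inv_mul_le_iff₀ hp, max_le_iff, max_le_iff, ← zpow_one_add₀ hp.ne',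
    add_comm 1 k]
  simp only [norm_sq_le_zpow]

lemma IsQNR.norm_qf_le_iff_mem_box {a : ℤ} (ha : IsQNR p a) (x : V p) (k : ℤ) :
    ‖qf p a x‖ ≤ (p : ℝ) ^ (-k) ↔ x ∈ box p (-radii k) := by
  have e1 : -k / 2 = -((k + 1) / 2) := by omega
  have e2 : (-k + 1) / 2 = -(k / 2) := by omega
  rw [ha.norm_qf_le_iff, e1, e2]
  simp [box, radii, Fin.forall_fin_succ, and_assoc]

lemma qfc_eq_qf (a : ℤ) (x : V p) : qfc p a x = qf p a ![x 3, x 2, x 1, x 0] := by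
  simp [qfc, qf]; ring

lemma IsQNR.norm_qfc_le_iff_mem_box {a : ℤ} (ha : IsQNR p a) (x : V p) (k : ℤ) :
    ‖qfc p a x‖ ≤ (p : ℝ) ^ k ↔ x ∈ box p (radii k) := by
  rw [qfc_eq_qf, ha.norm_qf_le_iff]
  simp [box, radii, Fin.forall_fin_succ]
  tauto

lemma IsQNR.qf_ne_zero {a : ℤ} (ha : IsQNR p a) {x : V p} (hx : x ≠ 0) : qf p a x ≠ 0 := by
  have hp : (0 : ℝ) < p := zero_lt_one.trans one_lt_cast
  contrapose! hx
  have h := (ha.norm_qf x).symm.le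
  rw [hx, norm_zero, max_le_iff, inv_mul_le_iff₀ hp, mul_zero, max_le_iff,
    max_le_iff] at h
  simp only [sq_nonpos_iff, norm_eq_zero] at h
  ext i
  fin_cases i <;> simp [h]

lemma IsQNR.qfc_ne_zero {a : ℤ} (ha : IsQNR p a) {x : V p} (hx : x ≠ 0) : qfc p a x ≠ 0 := by
  rw [qfc_eq_qf]
  refine ha.qf_ne_zero fun h => hx ?_
  ext i
  fin_cases i
  · simpa using congrFun h 3
  · simpa using congrFun h 2
  · simpa using congrFun h 1
  · simpa using congrFun h 0

end Norms

section Character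

variable {p} {χ : ℚ_[p] → ℂ}

lemma denseRange_intCast_div_pow :
    DenseRange fun mn : ℤ × ℕ => (mn.1 : ℚ_[p]) / (p : ℚ_[p]) ^ mn.2 := by
  have hp := one_lt_cast (p := p)
  have hp0 : (p : ℚ_[p]) ≠ 0 := by exact_mod_cast (Fact.out : p.Prime).ne_zero
  refine Metric.denseRange_iff.mpr fun y ε hε => ?_
  obtain ⟨n, hn⟩ := pow_unbounded_of_one_lt ‖y‖ hp
  have hnorm : ‖(p : ℚ_[p]) ^ n‖ = ((p : ℝ) ^ n)⁻¹ := by simp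
  have hz : ‖y * (p : ℚ_[p]) ^ n‖ ≤ 1 := by
    rw [norm_mul, hnorm, ← div_eq_mul_inv, div_le_one (by positivity)]
    exact hn.le
  obtain ⟨w, hw⟩ : ∃ w : ℤ_[p], (w : ℚ_[p]) = y * (p : ℚ_[p]) ^ n := ⟨⟨_, hz⟩, rfl⟩
  obtain ⟨m, hm⟩ := (Metric.denseRange_iff.mp (PadicInt.denseRange_intCast (p := p))) w
    (ε / (p : ℝ) ^ n) (by positivity)
  refine ⟨(m, n), ?_⟩
  rw [dist_eq_norm, PadicInt.norm_def] at hm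
  push_cast at hm
  rw [hw] at hm
  have : y - (m : ℚ_[p]) / (p : ℚ_[p]) ^ n =
      (y * (p : ℚ_[p]) ^ n - m) / (p : ℚ_[p]) ^ n := by
    field_simp
  rw [dist_eq_norm, this, norm_div, hnorm, div_inv_eq_mul]
  exact (lt_div_iff₀ (by positivity)).mp hm

lemma IsStdChar.map_add (hχ : IsStdChar p χ) (y z : ℚ_[p]) : χ (y + z) = χ y * χ z := by
  have hc := hχ.1
  have hp0 : (p : ℚ_[p]) ≠ 0 := by exact_mod_cast (Fact.out : p.Prime).ne_zero
  have hp1 : (p : ℂ) ≠ 0 := by exact_mod_cast (Fact.out : p.Prime).ne_zero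
  have hd := (denseRange_intCast_div_pow (p := p)).prodMap (denseRange_intCast_div_pow (p := p))
  refine congr_fun (hd.equalizer (g := fun yz : ℚ_[p] × ℚ_[p] => χ (yz.1 + yz.2))
    (h := fun yz => χ yz.1 * χ yz.2) (by fun_prop) (by fun_prop) ?_) (y, z)
  ext ⟨⟨m, n⟩, ⟨m', n'⟩⟩
  have e : (m : ℚ_[p]) / (p : ℚ_[p]) ^ n + (m' : ℚ_[p]) / (p : ℚ_[p]) ^ n' =
      ((m * p ^ n' + m' * p ^ n : ℤ) : ℚ_[p]) / (p : ℚ_[p]) ^ (n + n') := by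
    push_cast
    field_simp
    ring
  simp only [Function.comp_apply, Prod.map_apply, e, hχ.2, ← Complex.exp_add]
  congr 1
  push_cast
  field_simp
  ring

lemma IsStdChar.norm_eq_one (hχ : IsStdChar p χ) (y : ℚ_[p]) : ‖χ y‖ = 1 := by
  have hc := hχ.1
  refine congr_fun ((denseRange_intCast_div_pow (p := p)).equalizer (g := fun y => ‖χ y‖)
    (h := fun _ => 1) (by fun_prop) (by fun_prop) ?_) y
  ext ⟨m, n⟩
  have e : 2 * (Real.pi : ℂ) * Complex.I * (m : ℂ) / (p : ℂ) ^ n =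
      ((2 * Real.pi * m / (p : ℝ) ^ n : ℝ) : ℂ) * Complex.I := by
    push_cast; ring
  simp only [Function.comp_apply, hχ.2, e, Complex.norm_exp_ofReal_mul_I]

lemma IsStdChar.eq_one_of_norm_le_one (hχ : IsStdChar p χ) {y : ℚ_[p]} (hy : ‖y‖ ≤ 1) :
    χ y = 1 := by
  have hc := hχ.1
  refine congr_fun ((PadicInt.denseRange_intCast (p := p)).equalizer
    (g := fun y : ℤ_[p] => χ y) (h := fun _ => 1) (by fun_prop) (by fun_prop) ?_) ⟨y, hy⟩
  ext m
  have := hχ.2 m 0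
  simp only [pow_zero, div_one] at this
  simp only [Function.comp_apply, PadicInt.coe_intCast, this]
  exact Complex.exp_eq_one_iff.mpr ⟨m, by ring⟩

lemma IsStdChar.inv_prime_ne_one (hχ : IsStdChar p χ) : χ ((p : ℚ_[p])⁻¹) ≠ 1 := by
  have hp := (Fact.out : p.Prime)
  have h := hχ.2 1 1
  simp only [Int.cast_one, pow_one, one_div, mul_one] at h
  rw [h]
  exact (Complex.isPrimitiveRoot_exp p hp.ne_zero).ne_one hp.one_lt

end Character

section Boxes

variable {p}

lemma closedBall_zpow_succ (n : ℤ) :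
    Metric.closedBall (0 : ℚ_[p]) ((p : ℝ) ^ (n + 1)) = ⋃ c ∈ Finset.range p,
      (fun y => -((c : ℚ_[p]) * (p : ℚ_[p]) ^ (-(n + 1))) + y) ⁻¹'
        Metric.closedBall 0 ((p : ℝ) ^ n) := by
  have hp := one_lt_cast (p := p)
  have hp0 : (p : ℚ_[p]) ≠ 0 := by exact_mod_cast (Fact.out : p.Prime).ne_zero
  have hpn : ‖(p : ℚ_[p]) ^ (-(n + 1))‖ = (p : ℝ) ^ (n + 1) := by
    rw [Padic.norm_p_zpow, neg_neg]
  ext y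
  simp only [Set.mem_iUnion, Finset.mem_range, mem_preimage, mem_closedBall_zero_iff, exists_prop]
  constructor
  · intro hy
    have hz : ‖y * (p : ℚ_[p]) ^ (n + 1)‖ ≤ 1 := by
      rw [norm_mul, Padic.norm_p_zpow, zpow_neg, ← div_eq_mul_inv, div_le_one (by positivity)]
      exact hy
    obtain ⟨c, hc, h⟩ := PadicInt.exists_mem_range (⟨_, hz⟩ : ℤ_[p])
    refine ⟨c, hc, ?_⟩
    rw [IsLocalRing.mem_maximalIdeal, PadicInt.mem_nonunits, PadicInt.norm_def] at h
    replace h : ‖y * (p : ℚ_[p]) ^ (n + 1) - c‖ < 1 := h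
    have h' : ‖y * (p : ℚ_[p]) ^ (n + 1) - c‖ ≤ (p : ℝ) ^ (-1 : ℤ) :=
      (Padic.norm_le_pow_iff_norm_lt_pow_add_one _ (-1)).mpr (by simpa using h)
    have e : -((c : ℚ_[p]) * (p : ℚ_[p]) ^ (-(n + 1))) + y =
        (y * (p : ℚ_[p]) ^ (n + 1) - c) * (p : ℚ_[p]) ^ (-(n + 1)) := by
      rw [zpow_neg]
      field_simp
      ring
    rw [e, norm_mul, hpn]
    calc _ ≤ (p : ℝ) ^ (-1 : ℤ) * (p : ℝ) ^ (n + 1) := by gcongr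
      _ = (p : ℝ) ^ n := by rw [← zpow_add₀ (by positivity)]; congr 1; ring
  · rintro ⟨c, -, h⟩
    have h1 : ‖(c : ℚ_[p]) * (p : ℚ_[p]) ^ (-(n + 1))‖ ≤ (p : ℝ) ^ (n + 1) := by
      rw [norm_mul, hpn]
      exact mul_le_of_le_one_left (by positivity) (by simpa using Padic.norm_int_le_one (p := p) c)
    have h2 : (p : ℝ) ^ n ≤ (p : ℝ) ^ (n + 1) := zpow_le_zpow_right₀ hp.le (by omega)
    have e : y = (c : ℚ_[p]) * (p : ℚ_[p]) ^ (-(n + 1)) +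
      (-((c : ℚ_[p]) * (p : ℚ_[p]) ^ (-(n + 1))) + y) := by ring
    rw [e]
    exact (Padic.nonarchimedean _ _).trans (max_le h1 (h.trans h2))

lemma measureReal_closedBall_zpow_succ (ν : Measure ℚ_[p]) [ν.IsAddHaarMeasure] (n : ℤ) :
    ν.real (Metric.closedBall 0 ((p : ℝ) ^ (n + 1))) =
      p * ν.real (Metric.closedBall 0 ((p : ℝ) ^ n)) := by
  have hp := one_lt_cast (p := p)
  rw [closedBall_zpow_succ, Measure.real, measure_biUnion_finset]
  · simp only [measure_preimage_add]
    simp [Measure.real]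
  · intro c hc c' hc' hne
    refine Set.disjoint_left.mpr fun y hy hy' => ?_
    simp only [mem_preimage, mem_closedBall_zero_iff] at hy hy'
    have hd : ¬ (p : ℤ) ∣ (c : ℤ) - c' := by
      intro h
      have hc : c < p := by simpa using hc
      have hc' : c' < p := by simpa using hc'
      have := Int.eq_zero_of_abs_lt_dvd h (by rw [abs_lt]; omega)
      omega
    have h1 : ‖((c : ℤ) - (c' : ℤ) : ℚ_[p])‖ = 1 := by
      have := (Padic.norm_intCast_eq_one_iff (p := p) (z := (c : ℤ) - c')).mpr (by
        rw [isCoprime_comm]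
        exact (Nat.prime_iff_prime_int.mp Fact.out).irreducible.coprime_iff_not_dvd.mpr hd)
      exact_mod_cast this
    have e : ((c : ℤ) - (c' : ℤ) : ℚ_[p]) * (p : ℚ_[p]) ^ (-(n + 1)) =
      (-((c' : ℚ_[p]) * (p : ℚ_[p]) ^ (-(n + 1))) + y) +
        -(-((c : ℚ_[p]) * (p : ℚ_[p]) ^ (-(n + 1))) + y) := by push_cast; ring
    have h2 := (Padic.nonarchimedean _ _).trans (max_le hy' (by rwa [norm_neg] :
      ‖-(-((c : ℚ_[p]) * (p : ℚ_[p]) ^ (-(n + 1))) + y)‖ ≤ (p : ℝ) ^ n))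
    rw [← e, norm_mul, h1, one_mul, Padic.norm_p_zpow, neg_neg, zpow_le_zpow_iff_right₀ hp] at h2
    omega
  · intro c _
    exact (measurable_const_add _) Metric.isClosed_closedBall.measurableSet

lemma measureReal_closedBall_zpow (ν : Measure ℚ_[p]) [ν.IsAddHaarMeasure] (n : ℤ) :
    ν.real (Metric.closedBall 0 ((p : ℝ) ^ n)) =
      (p : ℝ) ^ n * ν.real (Metric.closedBall 0 1) := by
  have hp : (p : ℝ) ≠ 0 := (zero_lt_one.trans one_lt_cast).ne'
  induction n using Int.induction_on with
  | zero => simp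
  | succ n ih => rw [measureReal_closedBall_zpow_succ, ih, zpow_add_one₀ hp]; ring
  | pred n ih =>
    rw [← sub_add_cancel (-(n : ℤ)) 1, measureReal_closedBall_zpow_succ, zpow_add_one₀ hp,
      mul_comm _ (p : ℝ), mul_assoc] at ih
    exact mul_left_cancel₀ hp ih

lemma box_eq_pi (r : Fin 4 → ℤ) :
    box p r = univ.pi fun i => Metric.closedBall (0 : ℚ_[p]) ((p : ℝ) ^ r i) := by
  ext; simp [box]

lemma isCompact_box (r : Fin 4 → ℤ) : IsCompact (box p r) := by
  rw [box_eq_pi]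
  exact isCompact_univ_pi fun i => isCompact_closedBall _ _

lemma measurableSet_box (r : Fin 4 → ℤ) : MeasurableSet (box p r) :=
  (isCompact_box r).isClosed.measurableSet

lemma box_zero : box p 0 = {x : V p | ‖x‖ ≤ 1} := by
  ext x
  simp [box, pi_norm_le_iff_of_nonneg]

lemma measureReal_box (μ : Measure (V p)) [μ.IsAddHaarMeasure]
    (hμ : μ {x : V p | ‖x‖ ≤ 1} = 1) (r : Fin 4 → ℤ) :
    μ.real (box p r) = (p : ℝ) ^ (∑ i, r i) := by
  have hp : (p : ℝ) ≠ 0 := (zero_lt_one.trans one_lt_cast).ne'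
  let ν : Measure ℚ_[p] := Measure.addHaar
  obtain ⟨C, hC⟩ : ∃ C : ℝ, ∀ r : Fin 4 → ℤ, μ.real (box p r) = C * (p : ℝ) ^ (∑ i, r i) := by
    refine ⟨μ.addHaarScalarFactor (Measure.pi fun _ => ν) * ν.real (Metric.closedBall 0 1) ^ 4,
      fun r => ?_⟩
    have h := DFunLike.congr_fun
      (Measure.isAddLeftInvariant_eq_smul μ (Measure.pi fun _ => ν)) (box p r)
    rw [Measure.smul_apply, box_eq_pi, Measure.pi_pi, ENNReal.smul_def, smul_eq_mul] at h
    rw [Measure.real, box_eq_pi, h, ENNReal.toReal_mul, ENNReal.toReal_prod]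
    simp only [← Measure.real_def, measureReal_closedBall_zpow, Fin.prod_univ_four,
      Fin.sum_univ_four, zpow_add₀ hp, ENNReal.coe_toReal]
    ring
  have h1 := hC 0
  rw [box_zero, Measure.real, hμ] at h1
  have hC1 : C = 1 := by simpa using h1.symm
  rw [hC, hC1, one_mul]

lemma sum_radii (k : ℤ) : ∑ i, radii k i = 2 * k := by
  simp [radii, Fin.sum_univ_four]
  omega

lemma integral_indicator_eq_zero {G : Type*} [AddGroup G] [MeasurableSpace G] [MeasurableAdd G]
    (μ : Measure G) [μ.IsAddRightInvariant] {S : Set G} {ψ : G → ℂ} {η : G}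
    (hS : ∀ ξ, ξ + η ∈ S ↔ ξ ∈ S) (hψ : ∀ ξ, ψ (ξ + η) = ψ ξ * ψ η) (hη : ψ η ≠ 1) :
    ∫ ξ, S.indicator ψ ξ ∂μ = 0 := by
  have h := integral_add_right_eq_self (μ := μ) (S.indicator ψ) η
  have e : ∀ ξ, S.indicator ψ (ξ + η) = S.indicator ψ ξ * ψ η := fun ξ => by
    by_cases hξ : ξ ∈ S
    · rw [indicator_of_mem hξ, indicator_of_mem ((hS ξ).mpr hξ), hψ]
    · rw [indicator_of_notMem hξ, indicator_of_notMem (mt (hS ξ).mp hξ), zero_mul]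
  simp only [e, integral_mul_const] at h
  exact (mul_right_eq_self₀.mp h).resolve_left hη

lemma add_mem_box {r : Fin 4 → ℤ} {ξ η : V p} (hξ : ξ ∈ box p r) (hη : η ∈ box p r) :
    ξ + η ∈ box p r := fun i =>
  (Padic.nonarchimedean _ _).trans (max_le (hξ i) (hη i))

lemma neg_mem_box {r : Fin 4 → ℤ} {ξ : V p} (hξ : ξ ∈ box p r) : -ξ ∈ box p r := fun i => by
  simpa using hξ i

lemma integral_indicator_box (μ : Measure (V p)) [μ.IsAddHaarMeasure]
    (hμ : μ {x : V p | ‖x‖ ≤ 1} = 1) {χ : ℚ_[p] → ℂ} (hχ : IsStdChar p χ) (r : Fin 4 → ℤ)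
    (x : V p) [Decidable (x ∈ box p (-r))] :
    ∫ ξ, (box p r).indicator (fun ξ => χ (∑ i, ξ i * x i)) ξ ∂μ =
      if x ∈ box p (-r) then (p : ℂ) ^ (∑ i, r i) else 0 := by
  have hp := one_lt_cast (p := p)
  split_ifs with hx
  · have h1 : ∀ ξ ∈ box p r, χ (∑ i, ξ i * x i) = 1 := fun ξ hξ => by
      refine hχ.eq_one_of_norm_le_one ?_
      refine IsUltrametricDist.norm_sum_le_of_forall_le_of_nonneg zero_le_one fun i _ => ?_
      rw [norm_mul]
      calc _ ≤ (p : ℝ) ^ r i * (p : ℝ) ^ (-r i) := by gcongr; exacts [hξ i, hx i]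
        _ = 1 := by rw [← zpow_add₀ (by positivity)]; simp
    rw [Set.indicator_congr h1, integral_indicator_const _ (measurableSet_box r),
      measureReal_box μ hμ]
    simp
  · simp only [box, Set.mem_ofPred_eq, not_forall, not_le] at hx
    obtain ⟨i, hi⟩ := hx
    have hxi : x i ≠ 0 := by
      rw [← norm_pos_iff]; exact lt_trans (by positivity) hi
    have hη : Pi.single i ((p : ℚ_[p])⁻¹ * (x i)⁻¹) ∈ box p r := by
      intro j
      rcases eq_or_ne j i with rfl | hj
      · rw [Pi.single_eq_same, norm_mul, norm_inv, norm_inv, Padic.norm_p, inv_inv,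
          ← div_eq_mul_inv, div_le_iff₀ (norm_pos_iff.mpr hxi)]
        obtain ⟨n, hn⟩ := exists_norm_eq_zpow hxi
        rw [hn, Pi.neg_apply, zpow_lt_zpow_iff_right₀ hp] at hi
        rw [hn, ← zpow_add₀ (by positivity)]
        simpa using zpow_le_zpow_right₀ hp.le (show (1 : ℤ) ≤ r j + n by omega)
      · rw [Pi.single_eq_of_ne hj, norm_zero]
        positivity
    refine integral_indicator_eq_zero μ (η := Pi.single i ((p : ℚ_[p])⁻¹ * (x i)⁻¹))
      (fun ξ => ⟨fun h => ?_, fun h => add_mem_box h hη⟩) (fun ξ => ?_) ?_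
    · simpa using add_mem_box h (neg_mem_box hη)
    · rw [← hχ.map_add, ← Finset.sum_add_distrib]
      simp [add_mul]
    · have e : ∑ j, (Pi.single i ((p : ℚ_[p])⁻¹ * (x i)⁻¹) : V p) j * x j = (p : ℚ_[p])⁻¹ := by
        rw [Finset.sum_eq_single i (fun j _ hj => by simp [hj]) (by simp)]
        simp [hxi]
      rw [e]
      exact hχ.inv_prime_ne_one

end Boxes

section Series

variable {p}

/-- Two-sided summability of the shell weights of the heat kernel. -/
lemma summable_shells {q A s : ℝ} (hq : 1 < q) (hA : 1 < A) (hs : 0 < s) :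
    Summable fun k : ℤ =>
      (Real.exp (-(s * A ^ k)) - Real.exp (-(s * A ^ (k + 1)))) * q ^ (2 * k) := by
  have hA0 : 0 < A := by linarith
  have hq0 : 0 < q := by linarith
  have hnn : ∀ k : ℤ,
      0 ≤ (Real.exp (-(s * A ^ k)) - Real.exp (-(s * A ^ (k + 1)))) * q ^ (2 * k) := fun k => by
    refine mul_nonneg (sub_nonneg.mpr ?_) (by positivity)
    gcongr
    · exact hA.le
    · omega
  have hle : ∀ k : ℤ, (Real.exp (-(s * A ^ k)) - Real.exp (-(s * A ^ (k + 1)))) * q ^ (2 * k) ≤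
      Real.exp (-(s * A ^ k)) * q ^ (2 * k) := fun k => by
    gcongr
    exact sub_le_self _ (Real.exp_pos _).le
  refine Summable.of_nat_of_neg ?_ ?_
  · obtain ⟨M, hM⟩ := pow_unbounded_of_one_lt (q ^ 2) hA
    have hr : q ^ 2 / A ^ M < 1 := (div_lt_one (by positivity)).mpr hM
    refine Summable.of_nonneg_of_le (fun k => hnn k) (fun k => (hle k).trans ?_)
      ((summable_geometric_of_lt_one (by positivity) hr).mul_left (M.factorial / s ^ M))
    have h := Real.pow_div_factorial_le_exp (s * A ^ k) (by positivity) M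
    rw [Real.exp_neg, zpow_natCast]
    calc (Real.exp (s * A ^ k))⁻¹ * q ^ (2 * (k : ℤ))
        ≤ ((s * A ^ k) ^ M / M.factorial)⁻¹ * q ^ (2 * (k : ℤ)) := by gcongr
      _ = _ := by
        rw [zpow_mul, zpow_natCast, zpow_ofNat, div_pow, mul_pow, ← pow_mul, ← pow_mul, ← pow_mul,
          mul_comm k M, inv_div]
        field_simp
  · refine Summable.of_nonneg_of_le (fun k => hnn _) (fun k => (hle _).trans ?_)
      (summable_geometric_of_lt_one (r := (q ^ 2)⁻¹) (by positivity)
        (inv_lt_one_of_one_lt₀ (one_lt_pow₀ hq two_ne_zero)))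
    refine (mul_le_of_le_one_left (by positivity) ?_).trans_eq ?_
    · exact Real.exp_le_one_iff.mpr (neg_nonpos.mpr (by positivity))
    · rw [zpow_mul, zpow_neg, zpow_natCast, zpow_ofNat, inv_pow]

lemma hasSum_telescope {A s : ℝ} (hA : 1 < A) (hs : 0 < s) (j : ℤ) :
    HasSum (fun k : ℤ => if j ≤ k then
      Real.exp (-(s * A ^ k)) - Real.exp (-(s * A ^ (k + 1))) else 0)
      (Real.exp (-(s * A ^ j))) := by
  have hA0 : 0 < A := by linarith
  have hinj : Function.Injective fun i : ℕ => j + i := fun a b h => by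
    simpa using h
  rw [← hinj.hasSum_iff]
  · have h0 : Tendsto (fun i : ℕ => Real.exp (-(s * A ^ (j + i)))) atTop (nhds 0) := by
      refine Real.tendsto_exp_neg_atTop_nhds_zero.comp ?_
      simp only [zpow_add₀ hA0.ne', zpow_natCast]
      exact ((tendsto_pow_atTop_atTop_of_one_lt hA).const_mul_atTop (by positivity)).const_mul_atTop
        hs
    rw [hasSum_iff_tendsto_nat_of_nonneg]
    · have := h0.const_sub (Real.exp (-(s * A ^ j)))
      rw [sub_zero] at this
      refine this.congr fun n => ?_
      have e := Finset.sum_range_sub' (fun i : ℕ => Real.exp (-(s * A ^ (j + (i : ℤ))))) n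
      simp only [Nat.cast_zero, add_zero] at e
      rw [← e]
      refine Finset.sum_congr rfl fun i _ => ?_
      simp [add_assoc]
    · intro i
      simp only [Function.comp_apply, le_add_iff_nonneg_right, Nat.cast_nonneg, if_true]
      rw [sub_nonneg, Real.exp_le_exp, neg_le_neg_iff, mul_le_mul_iff_right₀ hs]
      exact zpow_le_zpow_right₀ hA.le (by omega)
  · intro k hk
    rw [if_neg]
    intro h
    exact hk ⟨(k - j).toNat, by simp; omega⟩

/-- Summing the shells `k ≤ n` of the heat kernel by powers of `s`. -/
lemma hasSum_series_of_hasSum_shells {q A s S : ℝ} (hq : 1 < q) (hA : 1 < A) (n : ℤ)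
    (hS : HasSum (fun k : ℤ => if k ≤ n then
      (Real.exp (-(s * A ^ k)) - Real.exp (-(s * A ^ (k + 1)))) * q ^ (2 * k) else 0) S) :
    HasSum (fun m : ℕ => (-(s * A ^ n)) ^ (m + 1) / (m + 1).factorial * (1 - A ^ (m + 1)) *
      q ^ (2 * n) / (1 - (A ^ (m + 1))⁻¹ * (q ^ 2)⁻¹)) S := by
  have hA0 : 0 < A := by linarith
  have hq0 : 0 < q := by linarith
  have hQ : (q ^ 2)⁻¹ < 1 := inv_lt_one_of_one_lt₀ (one_lt_pow₀ hq two_ne_zero)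
  have hAm : ∀ m : ℕ, (A ^ (m + 1))⁻¹ ≤ 1 := fun m => inv_le_one_of_one_le₀ (one_le_pow₀ hA.le)
  set Y := s * A ^ n with hY
  let D : ℕ × ℕ → ℝ := fun z => (-Y) ^ (z.1 + 1) / (z.1 + 1).factorial * (1 - A ^ (z.1 + 1)) *
    q ^ (2 * n) * ((A ^ (z.1 + 1))⁻¹ * (q ^ 2)⁻¹) ^ z.2
  have hD : Summable D := by
    have hexp : Summable fun m : ℕ => (|Y| * A) ^ (m + 1) / (m + 1).factorial * q ^ (2 * n) :=
      ((summable_nat_add_iff 1).mpr (Real.summable_pow_div_factorial (|Y| * A))).mul_right _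
    refine Summable.of_norm_bounded (hexp.mul_of_nonneg
      (summable_geometric_of_lt_one (by positivity) hQ) (fun m => by positivity)
      (fun j => by positivity)) fun z => ?_
    have h1 : |1 - A ^ (z.1 + 1)| ≤ A ^ (z.1 + 1) := by
      have := one_le_pow₀ hA.le (n := z.1 + 1)
      rw [abs_le]; constructor <;> linarith
    have h2 : ((A ^ (z.1 + 1))⁻¹) ^ z.2 ≤ 1 := pow_le_one₀ (by positivity) (hAm _)
    calc ‖D z‖ = |Y| ^ (z.1 + 1) / (z.1 + 1).factorial * |1 - A ^ (z.1 + 1)| * q ^ (2 * n) *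
          (((A ^ (z.1 + 1))⁻¹) ^ z.2 * ((q ^ 2)⁻¹) ^ z.2) := by
          simp only [D, Real.norm_eq_abs, abs_mul, abs_div, abs_pow, abs_neg, mul_pow, abs_inv,
            abs_zpow, Nat.abs_cast, abs_of_pos hA0, abs_of_pos hq0]
      _ ≤ |Y| ^ (z.1 + 1) / (z.1 + 1).factorial * A ^ (z.1 + 1) * q ^ (2 * n) *
          (1 * ((q ^ 2)⁻¹) ^ z.2) := by gcongr
      _ = _ := by rw [mul_pow]; ring
  obtain ⟨T, hT⟩ := hD
  have hm : HasSum (fun m : ℕ => (-Y) ^ (m + 1) / (m + 1).factorial * (1 - A ^ (m + 1)) *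
      q ^ (2 * n) / (1 - (A ^ (m + 1))⁻¹ * (q ^ 2)⁻¹)) T := by
    refine hT.prod_fiberwise fun m => ?_
    rw [div_eq_mul_inv]
    refine (hasSum_geometric_of_lt_one (by positivity) ?_).mul_left _
    exact (mul_le_of_le_one_left (by positivity) (hAm m)).trans_lt hQ
  have hj : HasSum (fun j : ℕ => (Real.exp (-(s * A ^ (n - j))) -
      Real.exp (-(s * A ^ (n - j + 1)))) * q ^ (2 * (n - j))) T := by
    refine (HasSum.prod_fiberwise ((Equiv.prodComm ℕ ℕ).hasSum_iff.mpr hT)) fun j => ?_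
    have hexp : ∀ y : ℝ, HasSum (fun m : ℕ => y ^ (m + 1) / (m + 1).factorial)
        (Real.exp y - 1) := fun y => by
      have := NormedSpace.expSeries_div_hasSum_exp (𝔸 := ℝ) y
      rw [← Real.exp_eq_exp_ℝ, ← hasSum_nat_add_iff' 1] at this
      simpa using this
    have h := ((hexp (-(s * A ^ (n - j)))).sub (hexp (-(s * A ^ (n - j + 1))))).mul_right
      (q ^ (2 * (n - j)))
    rw [sub_sub_sub_cancel_right] at h
    refine h.congr_fun fun m => ?_
    have e1 : A ^ (n - j) = A ^ n * (A ^ j)⁻¹ := by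
      rw [zpow_sub₀ hA0.ne', zpow_natCast, div_eq_mul_inv]
    have e2 : q ^ (2 * (n - j)) = q ^ (2 * n) * ((q ^ 2)⁻¹) ^ j := by
      rw [mul_sub, zpow_sub₀ hq0.ne', zpow_mul q 2 j, zpow_natCast, zpow_ofNat, div_eq_mul_inv,
        inv_pow]
    have e3 : (A ^ j)⁻¹ ^ (m + 1) = ((A ^ (m + 1))⁻¹) ^ j := by
      rw [inv_pow, inv_pow, ← pow_mul, ← pow_mul, mul_comm]
    have e4 : -(s * A ^ (n - j)) = -Y * (A ^ j)⁻¹ := by rw [e1, hY]; ring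
    have e5 : -(s * A ^ (n - j + 1)) = -Y * (A ^ j)⁻¹ * A := by
      rw [zpow_add_one₀ hA0.ne', e1, hY]; ring
    rw [e4, e5, e2, mul_pow _ A, mul_pow (-Y), e3]
    simp only [D, Function.comp_apply, Equiv.prodComm_apply, Prod.swap_prod_mk, mul_pow]
    ring
  have hinj : Function.Injective fun i : ℕ => n - i := fun a b h => by
    simpa using h
  rw [← hinj.hasSum_iff] at hS
  · have : T = S := hj.unique (hS.congr_fun fun j => by simp)
    exact this ▸ hm
  · intro k hk
    rw [if_neg]
    intro h
    exact hk ⟨(n - k).toNat, by simp; omega⟩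

end Series

section HeatKernel

variable {p}

lemma continuous_qfc (a : ℤ) : Continuous fun ξ : V p => qfc p a ξ := by
  unfold qfc
  fun_prop

lemma zpow_rpow_comm {q : ℝ} (hq : 0 ≤ q) (α : ℝ) (k : ℤ) : (q ^ k) ^ α = (q ^ α) ^ k := by
  rw [← Real.rpow_intCast, ← Real.rpow_intCast, ← Real.rpow_mul hq, ← Real.rpow_mul hq, mul_comm]

lemma IsQNR.hasSum_exp_norm_qfc {a : ℤ} (ha : IsQNR p a) {s α : ℝ} (hs : 0 < s) (hα : 0 < α)
    {ξ : V p} (hξ : ξ ≠ 0) :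
    HasSum (fun k : ℤ => (box p (radii k)).indicator (fun _ =>
      Real.exp (-(s * ((p : ℝ) ^ α) ^ k)) - Real.exp (-(s * ((p : ℝ) ^ α) ^ (k + 1)))) ξ)
      (Real.exp (-(s * ‖qfc p a ξ‖ ^ α))) := by
  have hp := one_lt_cast (p := p)
  obtain ⟨j, hj⟩ := exists_norm_eq_zpow (ha.qfc_ne_zero hξ)
  rw [hj, zpow_rpow_comm (Nat.cast_nonneg p)]
  refine (hasSum_telescope (Real.one_lt_rpow hp hα) hs j).congr_fun fun k => ?_
  classical
  simp only [indicator_apply]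
  congr 1
  rw [← ha.norm_qfc_le_iff_mem_box, hj, zpow_le_zpow_iff_right₀ hp]

lemma IsQNR.hasSum_heatZ {a : ℤ} (ha : IsQNR p a) (μ : Measure (V p)) [μ.IsAddHaarMeasure]
    (hμ : μ {x : V p | ‖x‖ ≤ 1} = 1) {χ : ℚ_[p] → ℂ} (hχ : IsStdChar p χ) {κ α t : ℝ}
    (hs : 0 < κ * t) (hα : 0 < α) {x : V p} {n : ℤ} (hn : ‖qf p a x‖ = (p : ℝ) ^ (-n)) :
    HasSum (fun k : ℤ => ((if k ≤ n then
      (Real.exp (-(κ * t * ((p : ℝ) ^ α) ^ k)) - Real.exp (-(κ * t * ((p : ℝ) ^ α) ^ (k + 1)))) *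
        (p : ℝ) ^ (2 * k) else 0 : ℝ) : ℂ)) (heatZ p μ χ a κ α x t) := by
  have hp := one_lt_cast (p := p)
  have hA := Real.one_lt_rpow hp hα
  have hχc := hχ.1
  set w : ℤ → ℝ := fun k => Real.exp (-(κ * t * ((p : ℝ) ^ α) ^ k)) -
    Real.exp (-(κ * t * ((p : ℝ) ^ α) ^ (k + 1))) with hw
  have hw0 : ∀ k, 0 ≤ w k := fun k => by
    simp only [hw]
    rw [sub_nonneg, Real.exp_le_exp, neg_le_neg_iff, mul_le_mul_iff_right₀ hs]
    exact zpow_le_zpow_right₀ hA.le (by omega)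
  let ψ : V p → ℂ := fun ξ => χ (∑ i, ξ i * x i)
  have hψ : Continuous ψ := by fun_prop
  let F : ℤ → V p → ℂ := fun k ξ => (box p (radii k)).indicator ψ ξ * w k
  have hF : ∀ k, Integrable (F k) μ := fun k =>
    ((hψ.continuousOn.integrableOn_compact (isCompact_box _)).integrable_indicator
      (measurableSet_box _)).mul_const _
  have hnorm : ∀ k, ∫ ξ, ‖F k ξ‖ ∂μ = w k * (p : ℝ) ^ (2 * k) := fun k => by
    have e : ∀ ξ, ‖F k ξ‖ = (box p (radii k)).indicator (fun _ => w k) ξ := fun ξ => by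
      simp only [F, norm_mul, Complex.norm_real, Real.norm_of_nonneg (hw0 k)]
      by_cases hξ : ξ ∈ box p (radii k)
      · simp [hξ, ψ, hχ.norm_eq_one]
      · simp [hξ]
    simp only [e]
    rw [integral_indicator_const _ (measurableSet_box _), measureReal_box μ hμ, sum_radii,
      smul_eq_mul, mul_comm]
  have hsum : Summable fun k => ∫ ξ, ‖F k ξ‖ ∂μ := by
    simp only [hnorm]
    exact summable_shells hp hA hs
  have h := hasSum_integral_of_summable_integral_norm hF hsum
  have := Module.punctured_nhds_neBot ℚ_[p] (V p) 0
  have hint : ∫ ξ, ∑' k, F k ξ ∂μ = heatZ p μ χ a κ α x t := by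
    refine integral_congr_ae ?_
    filter_upwards [Measure.ae_ne μ (0 : V p)] with ξ hξ
    have h1 := Complex.hasSum_ofReal.mpr (ha.hasSum_exp_norm_qfc hs hα hξ)
    refine ((h1.mul_left (ψ ξ)).congr_fun fun k => ?_).tsum_eq
    by_cases hk : ξ ∈ box p (radii k)
    · simp [F, hk, hw]
    · simp [F, hk]
  rw [hint] at h
  refine h.congr_fun fun k => ?_
  classical
  have hbox : x ∈ box p (-radii k) ↔ k ≤ n := by
    rw [← ha.norm_qf_le_iff_mem_box, hn, zpow_le_zpow_iff_right₀ hp, neg_le_neg_iff]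
  simp only [F]
  rw [integral_mul_const, integral_indicator_box μ hμ hχ, sum_radii, ite_mul, zero_mul]
  simp only [hbox]
  split_ifs
  · push_cast [hw]; rw [mul_comm]
  · simp

lemma heatTerm_eq (a : ℤ) (κ α : ℝ) {x : V p} (t : ℝ) {n : ℤ}
    (hn : ‖qf p a x‖ = (p : ℝ) ^ (-n)) (m : ℕ) :
    heatTerm p a κ α x t m = (-(κ * t * ((p : ℝ) ^ α) ^ n)) ^ m / m.factorial *
      (1 - ((p : ℝ) ^ α) ^ m) * (p : ℝ) ^ (2 * n) /
        (1 - (((p : ℝ) ^ α) ^ m)⁻¹ * ((p : ℝ) ^ 2)⁻¹) := by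
  have hp : (0 : ℝ) < p := zero_lt_one.trans one_lt_cast
  have e1 : (p : ℝ) ^ (α * m) = ((p : ℝ) ^ α) ^ m := by
    rw [Real.rpow_mul hp.le, Real.rpow_natCast]
  have e2 : ∀ y : ℝ, 0 < y → y ^ (-(α * m) - 2) = ((y ^ α) ^ m)⁻¹ * (y ^ 2)⁻¹ := fun y hy => by
    rw [Real.rpow_sub hy, Real.rpow_neg hy.le, Real.rpow_mul hy.le, Real.rpow_natCast,
      div_eq_mul_inv]
    norm_num
  rw [heatTerm, hn, e1, e2 _ hp, e2 _ (by positivity), zpow_rpow_comm (Nat.cast_nonneg p), zpow_neg, zpow_neg,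
    inv_pow, inv_pow, inv_inv, inv_inv, mul_comm 2 n, zpow_mul, zpow_ofNat, neg_pow (κ * t * _),
    mul_pow, mul_pow]
  ring

end HeatKernel

/-- for `x ≠ 0` and `t > 0` the heat kernel has the absolutely convergent
series expansion `Z(x,t) = Σ_{m≥1} ((−1)^m/m!) ((1−p^{αm})/(1−p^{−αm−2})) κ^m t^m |f(x)|_p^{−αm−2}`. -/
theorem statement2
    (hp : p ≠ 2) (a : ℤ) (ha : IsQNR p a)
    (μ : Measure (V p)) [μ.IsAddHaarMeasure] (hμ : μ {x : V p | ‖x‖ ≤ 1} = 1)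
    (χ : ℚ_[p] → ℂ) (hχ : IsStdChar p χ)
    (κ α : ℝ) (hκ : 0 < κ) (hα : 0 < α)
    (x : V p) (hx : x ≠ 0) (t : ℝ) (ht : 0 < t) :
    Summable (fun m : ℕ => |heatTerm p a κ α x t (m + 1)|) ∧
    HasSum (fun m : ℕ => (heatTerm p a κ α x t (m + 1) : ℂ)) (heatZ p μ χ a κ α x t) := by
  have hf := ha.qf_ne_zero hx
  have hn : ‖qf p a x‖ = (p : ℝ) ^ (-(qf p a x).valuation) := Padic.norm_eq_zpow_neg_valuation hf
  have hp := one_lt_cast (p := p)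
  have hZ := ha.hasSum_heatZ μ hμ hχ (mul_pos hκ ht) hα hn
  obtain ⟨S, hS⟩ := Complex.summable_ofReal.mp hZ.summable
  have hZS := hZ.unique (Complex.hasSum_ofReal.mpr hS)
  have h := hasSum_series_of_hasSum_shells hp (Real.one_lt_rpow hp hα) _ hS
  simp only [← heatTerm_eq a κ α t hn] at h
  exact ⟨h.summable.abs, hZS ▸ Complex.hasSum_ofReal.mpr h⟩

end PadicParabolic
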